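/- Let a, b be positive real numbers with a ≠ b, let k ≥ 0 be an integer, and set δ = π/3. Then ∫₀^∞ t (log t)^k / ((t² − a t + a²)(t² − b t + b²)) dt = (δ^{k+1}(a+b)/(a³−b³)) · [P_k(log a / δ) − P_k(log b / δ)] + (δ^{k+1}/(√3 (a² + a b + b²))) · [Q_k(log a / δ) + Q_k(log b / δ)]. -/

import Mathlib

open Finset

/-- Non-recursive part of `Rpoly`. -/
noncomputable def GR (k : ℕ) : Polynomial ℝ :=
  Polynomial.C ((1 : ℝ) / (2 * (k + 1))) *
    ∑ j ∈ (Finset.range (k + 2)).filter (fun j => Even j),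
      Polynomial.C ((-1 : ℝ) ^ (j / 2) * ((k + 1).choose j : ℝ) * ((2 : ℝ) ^ j + 1)) *
        Polynomial.X ^ (k + 1 - j)

noncomputable def GS (k : ℕ) : Polynomial ℝ :=
  Polynomial.C ((1 : ℝ) / (2 * (k + 1))) *
    ∑ j ∈ (Finset.range (k + 2)).filter (fun j => Odd j),
      Polynomial.C ((-1 : ℝ) ^ ((j + 1) / 2) * ((k + 1).choose j : ℝ) * ((2 : ℝ) ^ j - 1)) *
        Polynomial.X ^ (k + 1 - j)

noncomputable def GP (k : ℕ) : Polynomial ℝ :=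
  Polynomial.C ((1 : ℝ) / (2 * (k + 1))) *
    ∑ j ∈ (Finset.range (k + 2)).filter (fun j => Even j),
      Polynomial.C ((-1 : ℝ) ^ (j / 2) * ((k + 1).choose j : ℝ) * ((5 : ℝ) ^ j + 1)) *
        Polynomial.X ^ (k + 1 - j)

noncomputable def GQ (k : ℕ) : Polynomial ℝ :=
  Polynomial.C ((1 : ℝ) / (2 * (k + 1))) *
    ∑ j ∈ (Finset.range (k + 2)).filter (fun j => Odd j),
      Polynomial.C ((-1 : ℝ) ^ ((j - 1) / 2) * ((k + 1).choose j : ℝ) * ((5 : ℝ) ^ j - 1)) *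
        Polynomial.X ^ (k + 1 - j)

noncomputable def GY (k : ℕ) : Polynomial ℝ :=
  Polynomial.C (-((1 : ℝ) / (k + 1))) *
    (Polynomial.X ^ (k + 1) +
      ∑ j ∈ (Finset.range (k + 2)).filter (fun j => Even j),
        Polynomial.C ((-1 : ℝ) ^ (j / 2) * ((k + 1).choose j : ℝ) * ((3 : ℝ) ^ j)) *
          Polynomial.X ^ (k + 1 - j))

noncomputable def GZ (k : ℕ) : Polynomial ℝ :=
  Polynomial.C (-((2 : ℝ) / (k + 1))) *
    ∑ j ∈ (Finset.range (k + 2)).filter (fun j => Even j),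
      Polynomial.C ((-1 : ℝ) ^ (j / 2) * ((k + 1).choose j : ℝ) * ((3 : ℝ) ^ j)) *
        Polynomial.X ^ (k + 1 - j)

/-- The common recursion: `F k = (1/(k+1)) ∑_{3 ≤ j ≤ k+1, j odd}
(−1)^{(j+1)/2} C(k+1,j) m^{j−1} F_{k+1−j} + G k`. -/
noncomputable def recFam (m : ℝ) (G : ℕ → Polynomial ℝ) : ℕ → Polynomial ℝ := fun k =>
  Nat.strongRecOn k fun k ih =>
    Polynomial.C ((1 : ℝ) / (k + 1)) *
      (∑ j ∈ ((Finset.range (k + 2)).filter (fun j => Odd j ∧ 3 ≤ j)).attach,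
        Polynomial.C ((-1 : ℝ) ^ ((j.1 + 1) / 2) * ((k + 1).choose j.1 : ℝ) * m ^ (j.1 - 1)) *
          ih (k + 1 - j.1) (by
            have hj := j.2
            simp only [Finset.mem_filter, Finset.mem_range] at hj
            omega))
    + G k

noncomputable def Rpoly : ℕ → Polynomial ℝ := recFam 3 GR
noncomputable def Spoly : ℕ → Polynomial ℝ := recFam 3 GS
noncomputable def Ppoly : ℕ → Polynomial ℝ := recFam 6 GP
noncomputable def Qpoly : ℕ → Polynomial ℝ := recFam 6 GQ
noncomputable def Ypoly : ℕ → Polynomial ℝ := recFam 3 GY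
noncomputable def Zpoly : ℕ → Polynomial ℝ := recFam 6 GZ

open MeasureTheory

theorem hasMellin_one_div_one_add {s : ℂ} (h0 : 0 < s.re) (h1 : s.re < 1) :
    HasMellin (fun t : ℝ => ((1 / (1 + t) : ℝ) : ℂ)) s (Real.pi / Complex.sin (Real.pi * s)) := by
  have hderiv : ∀ t ∈ Set.Ioi (0 : ℝ),
      HasDerivWithinAt (fun u : ℝ => u / (1 + u)) (1 / (1 + t) ^ 2) (Set.Ioi 0) t := by
    intro t ht
    have ht' : (1 + t) ≠ 0 := by have : 0 < t := ht; positivity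
    convert! ((hasDerivAt_id t).div ((hasDerivAt_id t).const_add 1) ht').hasDerivWithinAt using 1
    simp
  have hinj : Set.InjOn (fun u : ℝ => u / (1 + u)) (Set.Ioi 0) := by
    intro x hx y hy hxy
    have hx' : 0 < x := hx
    have hy' : 0 < y := hy
    simp only at hxy
    rw [div_eq_div_iff (by positivity) (by positivity)] at hxy
    linarith
  have himage : (fun u : ℝ => u / (1 + u)) '' Set.Ioi 0 = Set.Ioo 0 1 := by
    ext x
    constructor
    · rintro ⟨t, ht, rfl⟩
      have ht' : 0 < t := ht
      exact ⟨by simp only; positivity, by simp only; rw [div_lt_one (by positivity)]; linarith⟩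
    · rintro ⟨hx0, hx1⟩
      have : 0 < 1 - x := by linarith
      refine ⟨x / (1 - x), div_pos hx0 this, ?_⟩
      simp only
      field_simp
      ring
  have hcongr : Set.EqOn
      (fun t : ℝ => |1 / (1 + t) ^ 2| • (((t / (1 + t) : ℝ) : ℂ) ^ (s - 1) *
        (1 - ((t / (1 + t) : ℝ) : ℂ)) ^ (1 - s - 1)))
      (fun t : ℝ => (t : ℂ) ^ (s - 1) • ((1 / (1 + t) : ℝ) : ℂ)) (Set.Ioi 0) := by
    intro t ht
    have ht' : 0 < t := ht
    have hne : ((1 + t : ℝ) : ℂ) ≠ 0 := by exact_mod_cast (by positivity : (1 + t) ≠ 0)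
    have e : (1 : ℂ) - ((t / (1 + t) : ℝ) : ℂ) = (((1 + t)⁻¹ : ℝ) : ℂ) := by
      rw [← Complex.ofReal_one, ← Complex.ofReal_sub]
      congr 1
      field_simp
      ring
    simp only
    rw [e, abs_of_pos (by positivity), div_eq_mul_inv t, Complex.ofReal_mul,
      Complex.mul_cpow_ofReal_nonneg ht'.le (by positivity), mul_assoc,
      ← Complex.cpow_add _ _ (by rw [Complex.ofReal_inv]; exact inv_ne_zero hne),
      show s - 1 + (1 - s - 1) = -1 by ring, Complex.cpow_neg_one, Complex.real_smul, smul_eq_mul]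
    push_cast at hne ⊢
    field_simp
  have hint := (intervalIntegrable_iff_integrableOn_Ioo_of_le zero_le_one).1
    (Complex.betaIntegral_convergent (u := s) (v := 1 - s) h0 (by simpa using h1))
  constructor
  · rw [← himage, integrableOn_image_iff_integrableOn_abs_deriv_smul measurableSet_Ioi hderiv hinj,
      integrableOn_congr_fun hcongr measurableSet_Ioi] at hint
    exact hint
  · rw [mellin, ← setIntegral_congr_fun measurableSet_Ioi hcongr,
      ← integral_image_eq_integral_abs_deriv_smul measurableSet_Ioi hderiv hinj
        (fun x : ℝ => (x : ℂ) ^ (s - 1) * (1 - (x : ℂ)) ^ (1 - s - 1)), himage,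
      ← integral_Ioc_eq_integral_Ioo, ← intervalIntegral.integral_of_le zero_le_one,
      ← Complex.betaIntegral, Complex.betaIntegral_eq_Gamma_mul_div _ _ h0 (by simpa using h1),
      Complex.Gamma_mul_Gamma_one_sub]
    simp

theorem hasMellin_one_div_cube_add {c : ℝ} (hc : 0 < c) {s : ℂ} (h0 : 0 < s.re) (h3 : s.re < 3) :
    HasMellin (fun t : ℝ => ((1 / (t ^ 3 + c ^ 3) : ℝ) : ℂ)) s
      ((c : ℂ) ^ (s - 3) * (Real.pi / 3 / Complex.sin (Real.pi / 3 * s))) := by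
  have hs0 : 0 < (s / (3 : ℝ)).re := by
    rw [Complex.div_ofReal_re]; positivity
  have hs1 : (s / (3 : ℝ)).re < 1 := by
    rw [Complex.div_ofReal_re, div_lt_one (by norm_num)]; exact h3
  obtain ⟨hconv, heq⟩ := hasMellin_one_div_one_add hs0 hs1
  have hconv' := (((MellinConvergent.comp_mul_left (inv_pos.2 hc)).2
    ((MellinConvergent.comp_rpow three_ne_zero).2 hconv)).const_smul ((c : ℂ) ^ (-3 : ℂ)))
  have heq' : mellin (fun t : ℝ => (c : ℂ) ^ (-3 : ℂ) •
      ((1 / (1 + (c⁻¹ * t) ^ (3 : ℝ)) : ℝ) : ℂ)) s =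
      (c : ℂ) ^ (s - 3) * (Real.pi / 3 / Complex.sin (Real.pi / 3 * s)) := by
    rw [mellin_const_smul, mellin_comp_mul_left
      (fun t : ℝ => ((1 / (1 + t ^ (3 : ℝ)) : ℝ) : ℂ)) s (inv_pos.2 hc),
      mellin_comp_rpow (fun t : ℝ => ((1 / (1 + t) : ℝ) : ℂ)), heq]
    have hcc : (c : ℂ) ≠ 0 := by exact_mod_cast hc.ne'
    rw [Complex.ofReal_inv, Complex.inv_cpow _ _ (by
      rw [Complex.arg_ofReal_of_nonneg hc.le]; exact Real.pi_pos.ne),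
      ← Complex.cpow_neg, neg_neg, sub_eq_add_neg, Complex.cpow_add _ _ hcc,
      abs_of_pos (by norm_num : (0 : ℝ) < 3)]
    simp only [smul_eq_mul, Complex.real_smul]
    push_cast
    rw [show (Real.pi : ℂ) * (s / 3) = Real.pi / 3 * s by ring]
    ring
  have hcongr : Set.EqOn (fun t : ℝ => (t : ℂ) ^ (s - 1) • ((c : ℂ) ^ (-3 : ℂ) •
      ((1 / (1 + (c⁻¹ * t) ^ (3 : ℝ)) : ℝ) : ℂ)))
      (fun t : ℝ => (t : ℂ) ^ (s - 1) • ((1 / (t ^ 3 + c ^ 3) : ℝ) : ℂ)) (Set.Ioi 0) := by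
    intro t ht
    have ht' : 0 < t := ht
    simp only
    congr 1
    rw [Complex.cpow_neg, show (3 : ℂ) = ((3 : ℕ) : ℂ) by norm_num, Complex.cpow_natCast,
      show (3 : ℝ) = ((3 : ℕ) : ℝ) by norm_num, Real.rpow_natCast, smul_eq_mul]
    rw [← Complex.ofReal_pow, ← Complex.ofReal_inv, ← Complex.ofReal_mul]
    congr 1
    field_simp
    ring
  exact ⟨(integrableOn_congr_fun hcongr measurableSet_Ioi).1 hconv',
    (setIntegral_congr_fun measurableSet_Ioi hcongr).symm.trans heq'⟩

theorem Complex.sin_ne_zero_of_re_mem_Ioo {z : ℂ} (h0 : 0 < z.re) (hpi : z.re < Real.pi) :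
    Complex.sin z ≠ 0 := by
  rw [Complex.sin_ne_zero_iff]
  rintro k rfl
  rw [← Complex.ofReal_intCast, ← Complex.ofReal_mul, Complex.ofReal_re] at h0 hpi
  have h1 : (0 : ℝ) < k := pos_of_mul_pos_left h0 Real.pi_pos.le
  have h2 : (k : ℝ) < 1 := by
    by_contra! h
    nlinarith [Real.pi_pos]
  norm_cast at h1 h2
  omega

theorem sin_six_mul_partialFractions (c d u : ℂ) (h1 : Complex.sin (u + Real.pi / 3) ≠ 0)
    (h2 : Complex.sin (u + 2 * (Real.pi / 3)) ≠ 0) (h3 : Complex.sin (u + Real.pi) ≠ 0) :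
    Complex.sin (6 * u) * (-c / Complex.sin (u + Real.pi / 3)
        + (c + d) / Complex.sin (u + Real.pi) + d / Complex.sin (u + 2 * (Real.pi / 3))) =
      -3 * ((c + d) * (Complex.cos (5 * u) + Complex.cos u)
        + (c - d) / (Real.sqrt 3 : ℝ) * (Complex.sin (5 * u) - Complex.sin u)) := by
  have hr : ((Real.sqrt 3 : ℝ) : ℂ) ^ 2 = 3 := by
    rw [← Complex.ofReal_pow, Real.sq_sqrt (by norm_num)]; norm_num
  have hs : Complex.sin (Real.pi / 3) = (Real.sqrt 3 : ℝ) / 2 := by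
    have := Real.sin_pi_div_three
    exact_mod_cast congrArg ((↑) : ℝ → ℂ) this
  have hc : Complex.cos (Real.pi / 3) = 1 / 2 := by
    have := congrArg ((↑) : ℝ → ℂ) Real.cos_pi_div_three
    push_cast at this
    exact this
  have e1 : Complex.sin (u + Real.pi / 3) =
      (Complex.sin u + (Real.sqrt 3 : ℝ) * Complex.cos u) / 2 := by
    rw [Complex.sin_add, hs, hc]; ring
  have e2 : Complex.sin (u + 2 * (Real.pi / 3)) =
      ((Real.sqrt 3 : ℝ) * Complex.cos u - Complex.sin u) / 2 := by
    rw [Complex.sin_add, Complex.sin_two_mul, Complex.cos_two_mul, hs, hc]; ring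
  have e3 : Complex.sin (u + Real.pi) = -Complex.sin u := Complex.sin_add_pi u
  have e6 : Complex.sin (6 * u) = 2 * Complex.cos (3 * u) * (Complex.sin u *
      (Complex.sin u + (Real.sqrt 3 : ℝ) * Complex.cos u) *
      ((Real.sqrt 3 : ℝ) * Complex.cos u - Complex.sin u)) := by
    rw [show 6 * u = 2 * (3 * u) by ring, Complex.sin_two_mul, Complex.sin_three_mul]
    linear_combination (2 * Complex.cos (3 * u) * Complex.sin u) *
      (- Complex.cos u ^ 2 * hr - 3 * Complex.sin_sq_add_cos_sq u)
  have eA : Complex.cos (5 * u) + Complex.cos u =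
      2 * Complex.cos (3 * u) * (Complex.cos u ^ 2 - Complex.sin u ^ 2) := by
    rw [← Complex.cos_two_mul']
    conv_lhs => rw [show 5 * u = 3 * u + 2 * u by ring, show Complex.cos u =
      Complex.cos (3 * u - 2 * u) by ring_nf, Complex.cos_add, Complex.cos_sub]
    ring
  have eB : Complex.sin (5 * u) - Complex.sin u =
      2 * Complex.cos (3 * u) * (2 * Complex.sin u * Complex.cos u) := by
    rw [← Complex.sin_two_mul]
    conv_lhs => rw [show 5 * u = 3 * u + 2 * u by ring, show Complex.sin u =
      Complex.sin (3 * u - 2 * u) by ring_nf, Complex.sin_add, Complex.sin_sub]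
    ring
  rw [eA, eB, e6]
  rw [e1] at h1 ⊢
  rw [e2] at h2 ⊢
  rw [e3] at h3 ⊢
  generalize Complex.sin u = S at *
  generalize Complex.cos u = C at *
  generalize ((Real.sqrt 3 : ℝ) : ℂ) = r at *
  have h1' : S + r * C ≠ 0 := fun h => h1 (by rw [h]; simp)
  have h2' : r * C - S ≠ 0 := fun h => h2 (by rw [h]; simp)
  have h3' : S ≠ 0 := fun h => h3 (by rw [h]; simp)
  have hrinv : (c - d) / r = (c - d) * r / 3 := by
    rw [← hr]; field_simp
  rw [hrinv]
  field_simp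
  linear_combination (-Complex.cos (3 * u) * (c + d) * C ^ 2) * hr

/-- The Mellin transform of one of the two partial fractions of `t / ((t²-at+a²)(t²-bt+b²))`. -/
theorem hasMellin_partialFraction {c d : ℝ} (hc : 0 < c) {s : ℂ} (h0 : -1 < s.re)
    (h1 : s.re < 0) :
    HasMellin (fun t : ℝ => (((-c ^ 3 + (c + d) * t ^ 2 + c * d * t) / (t ^ 3 + c ^ 3) : ℝ) : ℂ))
      (s + 1) ((c : ℂ) ^ s * (Real.pi / 3) * (-c / Complex.sin (Real.pi / 3 * s + Real.pi / 3)
        + (c + d) / Complex.sin (Real.pi / 3 * s + Real.pi)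
        + d / Complex.sin (Real.pi / 3 * s + 2 * (Real.pi / 3)))) := by
  obtain ⟨i0, e0⟩ := hasMellin_one_div_cube_add hc (s := s + 1)
    (by simp; linarith) (by simp; linarith)
  obtain ⟨i1, e1⟩ := hasMellin_one_div_cube_add hc (s := s + 1 + 1)
    (by simp; linarith) (by simp; linarith)
  obtain ⟨i2, e2⟩ := hasMellin_one_div_cube_add hc (s := s + 1 + 2)
    (by simp; linarith) (by simp; linarith)
  have hcc : (c : ℂ) ≠ 0 := by exact_mod_cast hc.ne'
  rw [← mellin_cpow_smul] at e1 e2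
  rw [← MellinConvergent.cpow_smul] at i1 i2
  obtain ⟨j0, f0⟩ := hasMellin_const_smul i0 (-(c : ℂ) ^ 3)
  obtain ⟨j1, f1⟩ := hasMellin_const_smul i1 ((c : ℂ) * d)
  obtain ⟨j2, f2⟩ := hasMellin_const_smul i2 ((c : ℂ) + d)
  obtain ⟨j3, f3⟩ := hasMellin_add j0 j2
  obtain ⟨j4, f4⟩ := hasMellin_add j3 j1
  rw [f3, f0, f1, f2, e0, e1, e2] at f4
  have h : HasMellin _ _ _ := ⟨j4, f4⟩
  convert! h using 1
  · ext t
    simp only [Complex.cpow_one, smul_eq_mul]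
    rw [show (t : ℂ) ^ (2 : ℂ) = (t : ℂ) ^ 2 by
      rw [show (2 : ℂ) = ((2 : ℕ) : ℂ) by norm_num, Complex.cpow_natCast]]
    push_cast
    ring
  · rw [show s + 1 - 3 = s - (2 : ℕ) by push_cast; ring, show s + 1 + 1 - 3 = s - 1 by ring,
      show s + 1 + 2 - 3 = s by ring, Complex.cpow_sub _ _ hcc, Complex.cpow_sub _ _ hcc,
      Complex.cpow_natCast, Complex.cpow_one,
      show (Real.pi : ℂ) / 3 * (s + 1) = Real.pi / 3 * s + Real.pi / 3 by ring,
      show (Real.pi : ℂ) / 3 * (s + 1 + 1) = Real.pi / 3 * s + 2 * (Real.pi / 3) by ring,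
      show (Real.pi : ℂ) / 3 * (s + 1 + 2) = Real.pi / 3 * s + Real.pi by ring]
    simp only [smul_eq_mul]
    field_simp

theorem isBigO_log_pow_smul_atTop {f : ℝ → ℂ} {a a' : ℝ} (haa : a' < a)
    (hf : f =O[Filter.atTop] (· ^ (-a))) (n : ℕ) :
    (fun t : ℝ => Real.log t ^ n • f t) =O[Filter.atTop] (· ^ (-a')) := by
  induction n generalizing a' with
  | zero =>
    simp only [pow_zero, one_smul]
    refine hf.trans (Asymptotics.IsBigO.of_bound 1 ?_)
    filter_upwards [Filter.eventually_ge_atTop 1] with t ht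
    rw [one_mul, Real.norm_of_nonneg (by positivity), Real.norm_of_nonneg (by positivity)]
    exact Real.rpow_le_rpow_of_exponent_le ht (by linarith)
  | succ n ih =>
    have := isBigO_rpow_top_log_smul (show a' < (a' + a) / 2 by linarith)
      (ih (show (a' + a) / 2 < a by linarith))
    simpa only [pow_succ', mul_smul] using this

theorem isBigO_log_pow_smul_nhdsGT_zero {f : ℝ → ℂ} {b b' : ℝ} (hbb : b < b')
    (hf : f =O[nhdsWithin 0 (Set.Ioi 0)] (· ^ (-b))) (n : ℕ) :
    (fun t : ℝ => Real.log t ^ n • f t) =O[nhdsWithin 0 (Set.Ioi 0)] (· ^ (-b')) := by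
  induction n generalizing b' with
  | zero =>
    simp only [pow_zero, one_smul]
    refine hf.trans (Asymptotics.IsBigO.of_bound 1 ?_)
    filter_upwards [Ioo_mem_nhdsGT (zero_lt_one' ℝ)] with t ht
    have ht0 : 0 < t := ht.1
    rw [one_mul, Real.norm_of_nonneg (by positivity), Real.norm_of_nonneg (by positivity)]
    exact Real.rpow_le_rpow_of_exponent_ge ht0 ht.2.le (by linarith)
  | succ n ih =>
    have := isBigO_rpow_zero_log_smul (show (b' + b) / 2 < b' by linarith)
      (ih (show b < (b' + b) / 2 by linarith))
    simpa only [pow_succ', mul_smul] using this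

theorem iteratedDeriv_mellin {f : ℝ → ℂ} {a b : ℝ} (hfc : ContinuousOn f (Set.Ioi 0))
    (htop : f =O[Filter.atTop] (· ^ (-a))) (hbot : f =O[nhdsWithin 0 (Set.Ioi 0)] (· ^ (-b)))
    (n : ℕ) {s : ℂ} (hsa : s.re < a) (hsb : b < s.re) :
    iteratedDeriv n (mellin f) s = mellin (fun t => Real.log t ^ n • f t) s := by
  induction n generalizing s with
  | zero => simp
  | succ n ih =>
    have hopen : {z : ℂ | z.re < a ∧ b < z.re} ∈ nhds s :=
      ((isOpen_lt Complex.continuous_re continuous_const).inter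
        (isOpen_lt continuous_const Complex.continuous_re)).mem_nhds ⟨hsa, hsb⟩
    have hev : iteratedDeriv n (mellin f) =ᶠ[nhds s]
        mellin (fun t => Real.log t ^ n • f t) := by
      filter_upwards [hopen] with z hz using ih hz.1 hz.2
    have hcont : ContinuousOn (fun t : ℝ => Real.log t ^ n • f t) (Set.Ioi 0) :=
      ContinuousOn.smul ((Real.continuousOn_log.mono fun t (ht : 0 < t) => ht.ne').pow n) hfc
    rw [iteratedDeriv_succ, hev.deriv_eq,
      (mellin_hasDerivAt_of_isBigO_rpow (hcont.locallyIntegrableOn measurableSet_Ioi)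
        (isBigO_log_pow_smul_atTop (show (s.re + a) / 2 < a by linarith) htop n)
        (by linarith)
        (isBigO_log_pow_smul_nhdsGT_zero (show b < (s.re + b) / 2 by linarith) hbot n)
        (by linarith)).2.deriv]
    simp only [pow_succ', mul_smul]

/-- The `j`-th derivative of `sin (m * ·)` at `0`. -/
def sinCoeff {R : Type*} [Ring R] (m : R) (j : ℕ) : R :=
  if Odd j then (-1) ^ (j / 2) * m ^ j else 0

/-- The `j`-th derivative of `cos (m * ·)` at `0`. -/
def cosCoeff {R : Type*} [Ring R] (m : R) (j : ℕ) : R :=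
  if Even j then (-1) ^ (j / 2) * m ^ j else 0

@[simp]
theorem Complex.ofReal_sinCoeff (m : ℝ) (j : ℕ) :
    ((sinCoeff m j : ℝ) : ℂ) = sinCoeff (m : ℂ) j := by
  unfold sinCoeff
  split_ifs <;> simp

@[simp]
theorem Complex.ofReal_cosCoeff (m : ℝ) (j : ℕ) :
    ((cosCoeff m j : ℝ) : ℂ) = cosCoeff (m : ℂ) j := by
  unfold cosCoeff
  split_ifs <;> simp

theorem iteratedDeriv_sin_const_mul_zero (m : ℂ) (n : ℕ) :
    iteratedDeriv n (fun s : ℂ => Complex.sin (m * s)) 0 = sinCoeff m n := by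
  rw [iteratedDeriv_comp_const_mul Complex.contDiff_sin, sinCoeff]
  rcases Nat.even_or_odd' n with ⟨k, rfl | rfl⟩
  · rw [Complex.iteratedDeriv_even_sin, if_neg (by simp)]
    simp
  · rw [Complex.iteratedDeriv_odd_sin, if_pos (by simp), show (2 * k + 1) / 2 = k by omega]
    simp [mul_comm]

theorem iteratedDeriv_cos_const_mul_zero (m : ℂ) (n : ℕ) :
    iteratedDeriv n (fun s : ℂ => Complex.cos (m * s)) 0 = cosCoeff m n := by
  rw [iteratedDeriv_comp_const_mul Complex.contDiff_cos, cosCoeff]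
  rcases Nat.even_or_odd' n with ⟨k, rfl | rfl⟩
  · rw [Complex.iteratedDeriv_even_cos, if_pos (by simp), show (2 * k) / 2 = k by omega]
    simp [mul_comm]
  · rw [Complex.iteratedDeriv_odd_cos, if_neg (by simp)]
    simp

theorem recFam_eq (m : ℝ) (G : ℕ → Polynomial ℝ) (k : ℕ) :
    recFam m G k = Polynomial.C ((1 : ℝ) / (k + 1)) *
      (∑ j ∈ (Finset.range (k + 2)).filter (fun j => Odd j ∧ 3 ≤ j),
        Polynomial.C ((-1 : ℝ) ^ ((j + 1) / 2) * ((k + 1).choose j : ℝ) * m ^ (j - 1)) *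
          recFam m G (k + 1 - j)) + G k := by
  conv_lhs => rw [recFam, Nat.strongRecOn_eq]
  congr 2
  exact Finset.sum_attach _ (fun j => Polynomial.C ((-1 : ℝ) ^ ((j + 1) / 2) *
    ((k + 1).choose j : ℝ) * m ^ (j - 1)) * recFam m G (k + 1 - j))

theorem sum_choose_mul_sinCoeff_mul_eval_recFam (m : ℝ) (G : ℕ → Polynomial ℝ) (k : ℕ) (x : ℝ) :
    ∑ j ∈ range (k + 2), ((k + 1).choose j : ℝ) * sinCoeff m j *
      (recFam m G (k + 1 - j)).eval x = m * (k + 1) * (G k).eval x := by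
  have hfilter : (range (k + 2)).filter (fun j => Odd j) =
      insert 1 ((range (k + 2)).filter (fun j => Odd j ∧ 3 ≤ j)) := by
    ext j
    simp only [mem_filter, mem_range, mem_insert]
    constructor
    · rintro ⟨h1, h2⟩
      obtain ⟨i, rfl⟩ := h2
      by_cases hi : i = 0
      · left; omega
      · right; exact ⟨h1, ⟨i, rfl⟩, by omega⟩
    · rintro (rfl | ⟨h1, h2, -⟩)
      · exact ⟨by omega, odd_one⟩
      · exact ⟨h1, h2⟩
  have hsum : ∑ j ∈ range (k + 2), ((k + 1).choose j : ℝ) * sinCoeff m j *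
      (recFam m G (k + 1 - j)).eval x =
      ∑ j ∈ (range (k + 2)).filter (fun j => Odd j), ((k + 1).choose j : ℝ) *
        ((-1) ^ (j / 2) * m ^ j) * (recFam m G (k + 1 - j)).eval x := by
    rw [sum_filter]
    refine sum_congr rfl fun j _ => ?_
    rw [sinCoeff]
    split_ifs <;> simp
  rw [hsum, hfilter, sum_insert (by simp)]
  have hrec : ((k : ℝ) + 1) * (recFam m G k).eval x =
      (∑ j ∈ (range (k + 2)).filter (fun j => Odd j ∧ 3 ≤ j), (-1 : ℝ) ^ ((j + 1) / 2) *
        ((k + 1).choose j : ℝ) * m ^ (j - 1) * (recFam m G (k + 1 - j)).eval x)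
      + (k + 1) * (G k).eval x := by
    rw [recFam_eq m G k]
    simp only [Polynomial.eval_add, Polynomial.eval_mul, Polynomial.eval_C,
      Polynomial.eval_finsetSum]
    field_simp
  have htail : ∑ j ∈ (range (k + 2)).filter (fun j => Odd j ∧ 3 ≤ j), ((k + 1).choose j : ℝ) *
        ((-1) ^ (j / 2) * m ^ j) * (recFam m G (k + 1 - j)).eval x =
      -m * ∑ j ∈ (range (k + 2)).filter (fun j => Odd j ∧ 3 ≤ j), (-1 : ℝ) ^ ((j + 1) / 2) *
        ((k + 1).choose j : ℝ) * m ^ (j - 1) * (recFam m G (k + 1 - j)).eval x := by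
    rw [mul_sum]
    refine sum_congr rfl fun j hj => ?_
    obtain ⟨i, rfl⟩ := (mem_filter.1 hj).2.1
    rw [show (2 * i + 1) / 2 = i by omega, show (2 * i + 1 + 1) / 2 = i + 1 by omega,
      show 2 * i + 1 - 1 = 2 * i by omega]
    ring
  rw [htail]
  simp only [Nat.choose_one_right, Nat.add_sub_cancel]
  push_cast
  norm_num
  linear_combination m * hrec

theorem sum_choose_mul_sinCoeff_mul_scaled_eval_recFam (m δ : ℝ) (G : ℕ → Polynomial ℝ) (k : ℕ)
    (x : ℝ) :
    ∑ j ∈ range (k + 2), ((k + 1).choose j : ℝ) * sinCoeff (m * δ) j *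
      (δ ^ (k + 1 - j + 1) * (recFam m G (k + 1 - j)).eval x) =
      δ ^ (k + 2) * (m * (k + 1) * (G k).eval x) := by
  rw [← sum_choose_mul_sinCoeff_mul_eval_recFam, mul_sum]
  refine sum_congr rfl fun j hj => ?_
  have hj' : j < k + 2 := mem_range.1 hj
  rw [show k + 2 = j + (k + 1 - j + 1) by omega, pow_add]
  unfold sinCoeff
  split_ifs
  · rw [mul_pow]; ring
  · ring

theorem pow_mul_eval_GP {δ : ℝ} (hδ : δ ≠ 0) (k : ℕ) (L : ℝ) :
    δ ^ (k + 1) * (2 * (k + 1) * (GP k).eval (L / δ)) =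
      ∑ j ∈ range (k + 2), ((k + 1).choose j : ℝ) * (cosCoeff (5 * δ) j + cosCoeff δ j) *
        L ^ (k + 1 - j) := by
  simp only [GP, Polynomial.eval_mul, Polynomial.eval_C, Polynomial.eval_finsetSum,
    Polynomial.eval_pow, Polynomial.eval_X]
  rw [← mul_assoc (2 * ((k : ℝ) + 1)), mul_one_div_cancel (by positivity), one_mul, sum_filter,
    mul_sum]
  refine sum_congr rfl fun j hj => ?_
  have hj' : j < k + 2 := mem_range.1 hj
  unfold cosCoeff
  split_ifs
  · conv_lhs => rw [show δ ^ (k + 1) = δ ^ j * δ ^ (k + 1 - j) by rw [← pow_add]; congr 1; omega]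
    rw [div_pow, mul_pow]
    field_simp
  · simp

theorem pow_mul_eval_GQ {δ : ℝ} (hδ : δ ≠ 0) (k : ℕ) (L : ℝ) :
    δ ^ (k + 1) * (2 * (k + 1) * (GQ k).eval (L / δ)) =
      ∑ j ∈ range (k + 2), ((k + 1).choose j : ℝ) * (sinCoeff (5 * δ) j - sinCoeff δ j) *
        L ^ (k + 1 - j) := by
  simp only [GQ, Polynomial.eval_mul, Polynomial.eval_C, Polynomial.eval_finsetSum,
    Polynomial.eval_pow, Polynomial.eval_X]
  rw [← mul_assoc (2 * ((k : ℝ) + 1)), mul_one_div_cancel (by positivity), one_mul, sum_filter,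
    mul_sum]
  refine sum_congr rfl fun j hj => ?_
  have hj' : j < k + 2 := mem_range.1 hj
  unfold sinCoeff
  split_ifs with hodd
  · conv_lhs => rw [show δ ^ (k + 1) = δ ^ j * δ ^ (k + 1 - j) by rw [← pow_add]; congr 1; omega]
    obtain ⟨i, rfl⟩ := hodd
    rw [div_pow, mul_pow, show (2 * i + 1 - 1) / 2 = (2 * i + 1) / 2 by omega]
    field_simp
  · simp

theorem eq_of_sum_choose_mul_sinCoeff_eq {m : ℝ} (hm : m ≠ 0) {X Y : ℕ → ℝ}
    (h : ∀ k, ∑ j ∈ range (k + 2), ((k + 1).choose j : ℝ) * sinCoeff m j * X (k + 1 - j) =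
      ∑ j ∈ range (k + 2), ((k + 1).choose j : ℝ) * sinCoeff m j * Y (k + 1 - j)) (k : ℕ) :
    X k = Y k := by
  induction k using Nat.strong_induction_on with
  | _ k ih =>
    have hk := h k
    rw [← sub_eq_zero, ← sum_sub_distrib, sum_eq_single 1] at hk
    · have hk' : ((k : ℝ) + 1) * m * (X k - Y k) = 0 := by
        simp [sinCoeff] at hk
        linear_combination hk
      have : (k + 1 : ℝ) * m ≠ 0 := mul_ne_zero (by positivity) hm
      exact sub_eq_zero.1 ((mul_eq_zero.1 hk').resolve_left this)
    · intro j hj hj1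
      have hj' : j < k + 2 := mem_range.1 hj
      rcases Nat.eq_zero_or_pos j with rfl | hpos
      · simp [sinCoeff]
      · rw [ih (k + 1 - j) (by omega), sub_self]
    · intro h1
      exact absurd (mem_range.2 (by omega)) h1

theorem three_div_four_mul_sq_le (t a : ℝ) : 3 / 4 * t ^ 2 ≤ t ^ 2 - a * t + a ^ 2 := by
  nlinarith [sq_nonneg (t / 2 - a)]

theorem sq_sub_mul_add_sq_pos {a : ℝ} (ha : 0 < a) (t : ℝ) : 0 < t ^ 2 - a * t + a ^ 2 := by
  nlinarith [sq_nonneg (t - a / 2), pow_pos ha 2]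

/-- The rational function `t / ((t²-at+a²)(t²-bt+b²))`, with complex values. -/
noncomputable def kernelFun (a b : ℝ) (t : ℝ) : ℂ :=
  ((t / ((t ^ 2 - a * t + a ^ 2) * (t ^ 2 - b * t + b ^ 2)) : ℝ) : ℂ)

theorem continuous_kernelFun {a b : ℝ} (ha : 0 < a) (hb : 0 < b) :
    Continuous (kernelFun a b) := by
  unfold kernelFun
  refine Complex.continuous_ofReal.comp (continuous_id.div (by fun_prop) fun t => ?_)
  exact (mul_pos (sq_sub_mul_add_sq_pos ha t) (sq_sub_mul_add_sq_pos hb t)).ne'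

theorem kernelFun_isBigO_atTop {a b : ℝ} (ha : 0 < a) (hb : 0 < b) :
    kernelFun a b =O[Filter.atTop] (· ^ (-3 : ℝ)) := by
  refine Asymptotics.IsBigO.of_bound (16 / 9) ?_
  filter_upwards [Filter.eventually_gt_atTop 0] with t ht
  have hqa := sq_sub_mul_add_sq_pos ha t
  have hqb := sq_sub_mul_add_sq_pos hb t
  rw [kernelFun, Complex.norm_real, Real.norm_of_nonneg (by positivity),
    Real.norm_of_nonneg (by positivity), Real.rpow_neg ht.le,
    show (3 : ℝ) = ((3 : ℕ) : ℝ) by norm_num, Real.rpow_natCast, div_le_iff₀ (by positivity)]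
  calc t = 16 / 9 * (t ^ 3)⁻¹ * ((3 / 4 * t ^ 2) * (3 / 4 * t ^ 2)) := by field_simp; norm_num
    _ ≤ _ := by
      gcongr
      · exact three_div_four_mul_sq_le t a
      · exact three_div_four_mul_sq_le t b

theorem kernelFun_isBigO_nhdsGT_zero {a b : ℝ} (ha : 0 < a) (hb : 0 < b) :
    kernelFun a b =O[nhdsWithin 0 (Set.Ioi 0)] (· ^ (-(-1) : ℝ)) := by
  refine Asymptotics.IsBigO.of_bound (16 / 9 * (a ^ 2 * b ^ 2)⁻¹) ?_
  filter_upwards [self_mem_nhdsWithin] with t ht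
  have ht' : 0 < t := ht
  have hqa := sq_sub_mul_add_sq_pos ha t
  have hqb := sq_sub_mul_add_sq_pos hb t
  rw [kernelFun, Complex.norm_real, Real.norm_of_nonneg (by positivity),
    neg_neg, Real.rpow_one, Real.norm_of_nonneg ht'.le, div_le_iff₀ (by positivity)]
  calc t = 16 / 9 * (a ^ 2 * b ^ 2)⁻¹ * t * ((3 / 4 * a ^ 2) * (3 / 4 * b ^ 2)) := by
        field_simp; norm_num
    _ ≤ _ := by
      gcongr
      · nlinarith [three_div_four_mul_sq_le a t]
      · nlinarith [three_div_four_mul_sq_le b t]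

theorem differentiableAt_mellin_kernelFun {a b : ℝ} (ha : 0 < a) (hb : 0 < b) {s : ℂ}
    (h0 : -1 < s.re) (h3 : s.re < 3) : DifferentiableAt ℂ (mellin (kernelFun a b)) s :=
  mellin_differentiableAt_of_isBigO_rpow
    ((continuous_kernelFun ha hb).continuousOn.locallyIntegrableOn measurableSet_Ioi)
    (kernelFun_isBigO_atTop ha hb) h3 (kernelFun_isBigO_nhdsGT_zero ha hb) h0

theorem differentiableAt_mellin_kernelFun_add_one {a b : ℝ} (ha : 0 < a) (hb : 0 < b) {s : ℂ}
    (h0 : -1 < s.re) (h1 : s.re < 1) :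
    DifferentiableAt ℂ (fun z => mellin (kernelFun a b) (z + 1)) s := by
  have h := differentiableAt_mellin_kernelFun ha hb (s := s + 1)
    (by simp; linarith) (by simp; linarith)
  exact DifferentiableAt.comp (g := mellin (kernelFun a b)) (f := fun z : ℂ => z + 1) s h
    (by fun_prop)

theorem iteratedDeriv_mellin_kernelFun {a b : ℝ} (ha : 0 < a) (hb : 0 < b) (n : ℕ) :
    iteratedDeriv n (fun s => mellin (kernelFun a b) (s + 1)) 0 =
      ((∫ t in Set.Ioi (0 : ℝ),
        t * Real.log t ^ n / ((t ^ 2 - a * t + a ^ 2) * (t ^ 2 - b * t + b ^ 2)) : ℝ) : ℂ) := by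
  rw [iteratedDeriv_comp_add_const]
  beta_reduce
  rw [zero_add,
    iteratedDeriv_mellin (continuous_kernelFun ha hb).continuousOn
      (kernelFun_isBigO_atTop ha hb) (kernelFun_isBigO_nhdsGT_zero ha hb) n
      (by norm_num) (by norm_num), mellin, ← integral_complex_ofReal]
  refine integral_congr_ae (Filter.Eventually.of_forall fun t => ?_)
  simp only [kernelFun, sub_self, Complex.cpow_zero, one_smul, Complex.real_smul]
  push_cast
  ring

/-- `sin (2πs)` times the Mellin transform of `kernelFun`, as an entire function of `s`. -/
noncomputable def mellinNumerator (a b : ℝ) (s : ℂ) : ℂ :=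
  Real.pi * ((a + b) / (a ^ 3 - b ^ 3) *
      ((Complex.cos ((5 * (Real.pi / 3) : ℝ) * s) + Complex.cos ((Real.pi / 3 : ℝ) * s)) *
          Complex.exp ((Real.log a : ℝ) * s)
        - (Complex.cos ((5 * (Real.pi / 3) : ℝ) * s) + Complex.cos ((Real.pi / 3 : ℝ) * s)) *
          Complex.exp ((Real.log b : ℝ) * s))
    + 1 / ((Real.sqrt 3 : ℝ) * (a ^ 2 + a * b + b ^ 2)) *
      ((Complex.sin ((5 * (Real.pi / 3) : ℝ) * s) - Complex.sin ((Real.pi / 3 : ℝ) * s)) *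
          Complex.exp ((Real.log a : ℝ) * s)
        + (Complex.sin ((5 * (Real.pi / 3) : ℝ) * s) - Complex.sin ((Real.pi / 3 : ℝ) * s)) *
          Complex.exp ((Real.log b : ℝ) * s)))

theorem sin_mul_mellin_kernelFun_of_re_neg {a b : ℝ} (ha : 0 < a) (hb : 0 < b) (hab : a ≠ b)
    {s : ℂ} (h0 : -1 < s.re) (h1 : s.re < 0) :
    Complex.sin ((6 * (Real.pi / 3) : ℝ) * s) * mellin (kernelFun a b) (s + 1) =
      mellinNumerator a b s := by
  obtain ⟨ia, ea⟩ := hasMellin_partialFraction (d := b) ha h0 h1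
  obtain ⟨ib, eb⟩ := hasMellin_partialFraction (d := a) hb h0 h1
  have hcube : a ^ 3 - b ^ 3 = (a - b) * (a ^ 2 + a * b + b ^ 2) := by ring
  have hq : a ^ 2 + a * b + b ^ 2 ≠ 0 := by positivity
  have hab3 : b ^ 3 - a ^ 3 ≠ 0 := by
    rw [← neg_sub, hcube]
    exact neg_ne_zero.2 (mul_ne_zero (sub_ne_zero.2 hab) hq)
  have hsub := (hasMellin_sub ia ib).2
  have hdiv : mellin (kernelFun a b) (s + 1) = mellin (fun t : ℝ =>
      ((((-a ^ 3 + (a + b) * t ^ 2 + a * b * t) / (t ^ 3 + a ^ 3) : ℝ) : ℂ)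
      - (((-b ^ 3 + (b + a) * t ^ 2 + b * a * t) / (t ^ 3 + b ^ 3) : ℝ) : ℂ))
        / ((b ^ 3 - a ^ 3 : ℝ) : ℂ)) (s + 1) := by
    refine setIntegral_congr_fun measurableSet_Ioi fun t ht => ?_
    have ht' : 0 < t := ht
    simp only [kernelFun]
    rw [← Complex.ofReal_sub, ← Complex.ofReal_div]
    congr 2
    have hqa := (sq_sub_mul_add_sq_pos ha t).ne'
    have hqb := (sq_sub_mul_add_sq_pos hb t).ne'
    rw [show t ^ 3 + a ^ 3 = (t + a) * (t ^ 2 - a * t + a ^ 2) by ring,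
      show t ^ 3 + b ^ 3 = (t + b) * (t ^ 2 - b * t + b ^ 2) by ring]
    have h1 : t + a ≠ 0 := by positivity
    have h2 : t + b ≠ 0 := by positivity
    rw [div_sub_div _ _ (mul_ne_zero h1 hqa) (mul_ne_zero h2 hqb), div_div,
      div_eq_div_iff (mul_ne_zero hqa hqb)
        (mul_ne_zero (mul_ne_zero (mul_ne_zero h1 hqa) (mul_ne_zero h2 hqb)) hab3)]
    ring
  rw [hdiv, mellin_div_const, hsub, ea, eb]
  have hre : ((Real.pi : ℂ) / 3 * s).re = Real.pi / 3 * s.re := by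
    rw [show (Real.pi : ℂ) / 3 = ((Real.pi / 3 : ℝ) : ℂ) by push_cast; rfl, Complex.re_ofReal_mul]
  have hpi := Real.pi_pos
  have hp3 : ((Real.pi : ℂ) / 3).re = Real.pi / 3 := by
    rw [show (Real.pi : ℂ) / 3 = ((Real.pi / 3 : ℝ) : ℂ) by push_cast; rfl, Complex.ofReal_re]
  have n1 : Complex.sin ((Real.pi : ℂ) / 3 * s + Real.pi / 3) ≠ 0 := by
    apply Complex.sin_ne_zero_of_re_mem_Ioo <;> rw [Complex.add_re, hre, hp3] <;> nlinarith
  have n2 : Complex.sin ((Real.pi : ℂ) / 3 * s + 2 * (Real.pi / 3)) ≠ 0 := by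
    apply Complex.sin_ne_zero_of_re_mem_Ioo <;>
      rw [Complex.add_re, hre, two_mul, Complex.add_re, hp3] <;> nlinarith
  have n3 : Complex.sin ((Real.pi : ℂ) / 3 * s + Real.pi) ≠ 0 := by
    apply Complex.sin_ne_zero_of_re_mem_Ioo <;>
      rw [Complex.add_re, hre, Complex.ofReal_re] <;> nlinarith
  have ta := sin_six_mul_partialFractions a b _ n1 n2 n3
  have tb := sin_six_mul_partialFractions b a _ n1 n2 n3
  have pa : (a : ℂ) ^ s = Complex.exp ((Real.log a : ℝ) * s) := by
    rw [Complex.cpow_def_of_ne_zero (by exact_mod_cast ha.ne'), Complex.ofReal_log ha.le]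
  have pb : (b : ℂ) ^ s = Complex.exp ((Real.log b : ℝ) * s) := by
    rw [Complex.cpow_def_of_ne_zero (by exact_mod_cast hb.ne'), Complex.ofReal_log hb.le]
  have hqC : (a : ℂ) ^ 2 + a * b + b ^ 2 ≠ 0 := by exact_mod_cast hq
  have habC : (a : ℂ) - b ≠ 0 := by exact_mod_cast sub_ne_zero.2 hab
  rw [mellinNumerator, pa, pb]
  push_cast
  rw [show (6 * ((Real.pi : ℂ) / 3)) * s = 6 * (Real.pi / 3 * s) by ring,
    show (5 * ((Real.pi : ℂ) / 3)) * s = 5 * (Real.pi / 3 * s) by ring]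
  calc _ = Real.pi / 3 / ((b : ℂ) ^ 3 - a ^ 3) *
        (Complex.exp (Real.log a * s) * (Complex.sin (6 * (Real.pi / 3 * s)) *
          (-a / Complex.sin (Real.pi / 3 * s + Real.pi / 3)
            + (a + b) / Complex.sin (Real.pi / 3 * s + Real.pi)
            + b / Complex.sin (Real.pi / 3 * s + 2 * (Real.pi / 3))))
        - Complex.exp (Real.log b * s) * (Complex.sin (6 * (Real.pi / 3 * s)) *
          (-b / Complex.sin (Real.pi / 3 * s + Real.pi / 3)
            + (b + a) / Complex.sin (Real.pi / 3 * s + Real.pi)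
            + a / Complex.sin (Real.pi / 3 * s + 2 * (Real.pi / 3))))) := by ring
    _ = _ := by
      rw [ta, tb]
      generalize Complex.cos (5 * (Real.pi / 3 * s)) = c5
      generalize Complex.sin (5 * (Real.pi / 3 * s)) = s5
      generalize Complex.cos (Real.pi / 3 * s) = c1
      generalize Complex.sin (Real.pi / 3 * s) = s1
      rw [show (b : ℂ) ^ 3 - a ^ 3 = -((a - b) * (a ^ 2 + a * b + b ^ 2)) by ring,
        show (a : ℂ) ^ 3 - b ^ 3 = (a - b) * (a ^ 2 + a * b + b ^ 2) by ring]
      field_simp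
      ring

theorem sin_mul_mellin_kernelFun_eventuallyEq {a b : ℝ} (ha : 0 < a) (hb : 0 < b) (hab : a ≠ b) :
    (fun s : ℂ => Complex.sin ((6 * (Real.pi / 3) : ℝ) * s) * mellin (kernelFun a b) (s + 1))
      =ᶠ[nhds 0] mellinNumerator a b := by
  set U : Set ℂ := {s | -1 < s.re ∧ s.re < 1} with hU
  have hUopen : IsOpen U :=
    (isOpen_lt continuous_const Complex.continuous_re).inter
      (isOpen_lt Complex.continuous_re continuous_const)
  have hUconv : Convex ℝ U :=
    (convex_halfSpace_re_gt (-1)).inter (convex_halfSpace_re_lt 1)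
  have hF : AnalyticOnNhd ℂ (fun s : ℂ =>
      Complex.sin ((6 * (Real.pi / 3) : ℝ) * s) * mellin (kernelFun a b) (s + 1)) U := by
    refine DifferentiableOn.analyticOnNhd (fun s hs => ?_) hUopen
    exact (DifferentiableAt.mul (by fun_prop)
      (differentiableAt_mellin_kernelFun_add_one ha hb hs.1 hs.2)).differentiableWithinAt
  have hG : AnalyticOnNhd ℂ (mellinNumerator a b) U := by
    refine DifferentiableOn.analyticOnNhd ?_ hUopen
    unfold mellinNumerator
    fun_prop
  have hmem : (-1 / 2 : ℂ) ∈ U := by constructor <;> norm_num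
  have hev : (fun s : ℂ =>
      Complex.sin ((6 * (Real.pi / 3) : ℝ) * s) * mellin (kernelFun a b) (s + 1))
      =ᶠ[nhds (-1 / 2 : ℂ)] mellinNumerator a b := by
    have hV : {s : ℂ | -1 < s.re ∧ s.re < 0} ∈ nhds (-1 / 2 : ℂ) :=
      ((isOpen_lt continuous_const Complex.continuous_re).inter
        (isOpen_lt Complex.continuous_re continuous_const)).mem_nhds (by constructor <;> norm_num)
    filter_upwards [hV] with s hs
    exact sin_mul_mellin_kernelFun_of_re_neg ha hb hab hs.1 hs.2
  have heq := hF.eqOn_of_preconnected_of_eventuallyEq hG hUconv.isPreconnected hmem hev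
  filter_upwards [hUopen.mem_nhds (by constructor <;> norm_num : (0 : ℂ) ∈ U)] with s hs
  exact heq hs

theorem iteratedDeriv_mul_exp_zero {f : ℂ → ℂ} {n : ℕ} (hf : ContDiff ℂ n f) (L : ℂ) :
    iteratedDeriv n (fun s => f s * Complex.exp (L * s)) 0 =
      ∑ j ∈ range (n + 1), (n.choose j : ℂ) * iteratedDeriv j f 0 * L ^ (n - j) := by
  rw [iteratedDeriv_fun_mul hf.contDiffAt (by fun_prop)]
  simp

theorem iteratedDeriv_mellinNumerator_zero (a b : ℝ) (n : ℕ) :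
    iteratedDeriv n (mellinNumerator a b) 0 =
      ((Real.pi * ((a + b) / (a ^ 3 - b ^ 3) *
          ((∑ j ∈ range (n + 1), (n.choose j : ℝ) *
              (cosCoeff (5 * (Real.pi / 3)) j + cosCoeff (Real.pi / 3) j) *
              Real.log a ^ (n - j))
            - ∑ j ∈ range (n + 1), (n.choose j : ℝ) *
              (cosCoeff (5 * (Real.pi / 3)) j + cosCoeff (Real.pi / 3) j) *
              Real.log b ^ (n - j))
        + 1 / (Real.sqrt 3 * (a ^ 2 + a * b + b ^ 2)) *
          ((∑ j ∈ range (n + 1), (n.choose j : ℝ) *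
              (sinCoeff (5 * (Real.pi / 3)) j - sinCoeff (Real.pi / 3) j) *
              Real.log a ^ (n - j))
            + ∑ j ∈ range (n + 1), (n.choose j : ℝ) *
              (sinCoeff (5 * (Real.pi / 3)) j - sinCoeff (Real.pi / 3) j) *
              Real.log b ^ (n - j))) : ℝ) : ℂ) := by
  have hcos : ∀ j, iteratedDeriv j (fun s : ℂ => Complex.cos ((5 * (Real.pi / 3) : ℝ) * s)
      + Complex.cos ((Real.pi / 3 : ℝ) * s)) 0 =
      ((cosCoeff (5 * (Real.pi / 3)) j + cosCoeff (Real.pi / 3) j : ℝ) : ℂ) := fun j => by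
    rw [iteratedDeriv_fun_add (by fun_prop) (by fun_prop), iteratedDeriv_cos_const_mul_zero,
      iteratedDeriv_cos_const_mul_zero, Complex.ofReal_add, Complex.ofReal_cosCoeff,
      Complex.ofReal_cosCoeff]
  have hsin : ∀ j, iteratedDeriv j (fun s : ℂ => Complex.sin ((5 * (Real.pi / 3) : ℝ) * s)
      - Complex.sin ((Real.pi / 3 : ℝ) * s)) 0 =
      ((sinCoeff (5 * (Real.pi / 3)) j - sinCoeff (Real.pi / 3) j : ℝ) : ℂ) := fun j => by
    rw [iteratedDeriv_fun_sub (by fun_prop) (by fun_prop), iteratedDeriv_sin_const_mul_zero,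
      iteratedDeriv_sin_const_mul_zero, Complex.ofReal_sub, Complex.ofReal_sinCoeff,
      Complex.ofReal_sinCoeff]
  unfold mellinNumerator
  rw [iteratedDeriv_const_mul_field, iteratedDeriv_fun_add (by fun_prop) (by fun_prop),
    iteratedDeriv_const_mul_field, iteratedDeriv_const_mul_field,
    iteratedDeriv_fun_add (by fun_prop) (by fun_prop),
    iteratedDeriv_fun_sub (by fun_prop) (by fun_prop),
    iteratedDeriv_mul_exp_zero (by fun_prop), iteratedDeriv_mul_exp_zero (by fun_prop),
    iteratedDeriv_mul_exp_zero (by fun_prop), iteratedDeriv_mul_exp_zero (by fun_prop)]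
  simp only [hcos, hsin]
  norm_cast

theorem sum_choose_mul_sinCoeff_mul_logMoment {a b : ℝ} (ha : 0 < a) (hb : 0 < b) (hab : a ≠ b)
    (n : ℕ) :
    ∑ j ∈ range (n + 1), (n.choose j : ℝ) * sinCoeff (6 * (Real.pi / 3)) j *
      (∫ t in Set.Ioi (0 : ℝ), t * Real.log t ^ (n - j) /
        ((t ^ 2 - a * t + a ^ 2) * (t ^ 2 - b * t + b ^ 2))) =
      Real.pi * ((a + b) / (a ^ 3 - b ^ 3) *
          ((∑ j ∈ range (n + 1), (n.choose j : ℝ) *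
              (cosCoeff (5 * (Real.pi / 3)) j + cosCoeff (Real.pi / 3) j) *
              Real.log a ^ (n - j))
            - ∑ j ∈ range (n + 1), (n.choose j : ℝ) *
              (cosCoeff (5 * (Real.pi / 3)) j + cosCoeff (Real.pi / 3) j) *
              Real.log b ^ (n - j))
        + 1 / (Real.sqrt 3 * (a ^ 2 + a * b + b ^ 2)) *
          ((∑ j ∈ range (n + 1), (n.choose j : ℝ) *
              (sinCoeff (5 * (Real.pi / 3)) j - sinCoeff (Real.pi / 3) j) *
              Real.log a ^ (n - j))
            + ∑ j ∈ range (n + 1), (n.choose j : ℝ) *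
              (sinCoeff (5 * (Real.pi / 3)) j - sinCoeff (Real.pi / 3) j) *
              Real.log b ^ (n - j))) := by
  have h := (sin_mul_mellin_kernelFun_eventuallyEq ha hb hab).iteratedDeriv_eq n
  have hJ : AnalyticAt ℂ (fun s : ℂ => mellin (kernelFun a b) (s + 1)) 0 := by
    rw [Complex.analyticAt_iff_eventually_differentiableAt]
    have hU : {s : ℂ | -1 < s.re ∧ s.re < 1} ∈ nhds (0 : ℂ) :=
      ((isOpen_lt continuous_const Complex.continuous_re).inter
        (isOpen_lt Complex.continuous_re continuous_const)).mem_nhds (by constructor <;> norm_num)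
    filter_upwards [hU] with s hs
    exact differentiableAt_mellin_kernelFun_add_one ha hb hs.1 hs.2
  rw [iteratedDeriv_fun_mul (by fun_prop) hJ.contDiffAt, iteratedDeriv_mellinNumerator_zero] at h
  rw [← Complex.ofReal_inj, ← h, Complex.ofReal_sum]
  refine sum_congr rfl fun j _ => ?_
  rw [iteratedDeriv_sin_const_mul_zero, iteratedDeriv_mellin_kernelFun ha hb, Complex.ofReal_mul,
    Complex.ofReal_mul, Complex.ofReal_sinCoeff, Complex.ofReal_natCast]

/-- The integral `f₂(k) = ∫₀^∞ t logᵏt /((t²−at+a²)(t²−bt+b²)) dt` in terms of the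
recursive polynomials `P_k` and `Q_k`, with `δ = π/3`. -/
theorem f2_eval (a b : ℝ) (ha : 0 < a) (hb : 0 < b) (hab : a ≠ b) (k : ℕ) :
    ∫ t in Set.Ioi (0 : ℝ),
        t * Real.log t ^ k / ((t ^ 2 - a * t + a ^ 2) * (t ^ 2 - b * t + b ^ 2)) =
      (Real.pi / 3) ^ (k + 1) * (a + b) / (a ^ 3 - b ^ 3) *
          ((Ppoly k).eval (Real.log a / (Real.pi / 3))
            - (Ppoly k).eval (Real.log b / (Real.pi / 3)))
        + (Real.pi / 3) ^ (k + 1) / (Real.sqrt 3 * (a ^ 2 + a * b + b ^ 2)) *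
          ((Qpoly k).eval (Real.log a / (Real.pi / 3))
            + (Qpoly k).eval (Real.log b / (Real.pi / 3))) := by
  have hδ : Real.pi / 3 ≠ 0 := by positivity
  refine eq_of_sum_choose_mul_sinCoeff_eq (m := 6 * (Real.pi / 3)) (by positivity)
    (X := fun k => ∫ t in Set.Ioi (0 : ℝ),
      t * Real.log t ^ k / ((t ^ 2 - a * t + a ^ 2) * (t ^ 2 - b * t + b ^ 2)))
    (Y := fun k => (Real.pi / 3) ^ (k + 1) * (a + b) / (a ^ 3 - b ^ 3) *
          ((Ppoly k).eval (Real.log a / (Real.pi / 3))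
            - (Ppoly k).eval (Real.log b / (Real.pi / 3)))
        + (Real.pi / 3) ^ (k + 1) / (Real.sqrt 3 * (a ^ 2 + a * b + b ^ 2)) *
          ((Qpoly k).eval (Real.log a / (Real.pi / 3))
            + (Qpoly k).eval (Real.log b / (Real.pi / 3)))) (fun k => ?_) k
  rw [sum_choose_mul_sinCoeff_mul_logMoment ha hb hab (k + 1), ← pow_mul_eval_GP hδ,
    ← pow_mul_eval_GP hδ, ← pow_mul_eval_GQ hδ, ← pow_mul_eval_GQ hδ]
  have hPa := sum_choose_mul_sinCoeff_mul_scaled_eval_recFam 6 (Real.pi / 3) GP k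
    (Real.log a / (Real.pi / 3))
  have hPb := sum_choose_mul_sinCoeff_mul_scaled_eval_recFam 6 (Real.pi / 3) GP k
    (Real.log b / (Real.pi / 3))
  have hQa := sum_choose_mul_sinCoeff_mul_scaled_eval_recFam 6 (Real.pi / 3) GQ k
    (Real.log a / (Real.pi / 3))
  have hQb := sum_choose_mul_sinCoeff_mul_scaled_eval_recFam 6 (Real.pi / 3) GQ k
    (Real.log b / (Real.pi / 3))
  calc _ = (a + b) / (a ^ 3 - b ^ 3) *
        ((Real.pi / 3) ^ (k + 2) * (6 * (k + 1) * (GP k).eval (Real.log a / (Real.pi / 3)))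
          - (Real.pi / 3) ^ (k + 2) * (6 * (k + 1) * (GP k).eval (Real.log b / (Real.pi / 3))))
      + 1 / (Real.sqrt 3 * (a ^ 2 + a * b + b ^ 2)) *
        ((Real.pi / 3) ^ (k + 2) * (6 * (k + 1) * (GQ k).eval (Real.log a / (Real.pi / 3)))
          + (Real.pi / 3) ^ (k + 2) * (6 * (k + 1) * (GQ k).eval (Real.log b / (Real.pi / 3)))) := by
        ring
    _ = _ := by
      rw [← hPa, ← hPb, ← hQa, ← hQb, ← sum_sub_distrib, ← sum_add_distrib, mul_sum, mul_sum,
        ← sum_add_distrib]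
      refine sum_congr rfl fun j _ => ?_
      simp only [Ppoly, Qpoly]
      ring
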